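/- Let D be an integral domain with quotient field K, and let R be an integral domain extending D; set A := R ∩ K. Then R is pseudo-polynomial over D if and only if R is pseudo-polynomial over A and A is pseudo-polynomial over D. -/

import Mathlib

/-- The quotient field of a subring `D` of a field `F`, realized as the subfield of `F`
generated by `D` (its elements are exactly the fractions `a/b` with `a, b ∈ D`, `b ≠ 0`). -/
def quotField {F : Type*} [Field F] (D : Subring F) : Subfield F :=
  Subfield.closure (D : Set F)

/-- An integral ideal `I` of `R` is *unitary* with respect to `D` if `I ∩ K ≠ (0)`,
where `K` is the quotient field of `D`. -/
def IsUnitaryIdeal {F : Type*} [Field F] (D R : Subring F) (I : Ideal R) : Prop :=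
  ∃ x : R, x ∈ I ∧ x ≠ 0 ∧ (x : F) ∈ quotField D

/-- `R` is *pseudo-polynomial* over `D` if every principal integral ideal of `R` that is
unitary with respect to `D` is generated by an element of `D`. -/
def IsPseudoPoly {F : Type*} [Field F] (D R : Subring F) : Prop :=
  ∀ r : R, IsUnitaryIdeal D R (Ideal.span {r}) →
    ∃ d : R, (d : F) ∈ D ∧ Ideal.span {r} = Ideal.span {d}

theorem quotField_inf_quotField {F : Type*} [Field F] {D R : Subring F} (hDR : D ≤ R) :
    quotField (R ⊓ (quotField D).toSubring) = quotField D := by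
  apply le_antisymm
  · exact Subfield.closure_le.2 fun x hx => hx.2
  · exact Subfield.closure_mono fun x hx => ⟨hDR hx, Subfield.subset_closure hx⟩

theorem isUnitaryIdeal_span_singleton_of_mem {F : Type*} [Field F] {D R : Subring F} {r : R}
    (hr : r ≠ 0) (hrD : (r : F) ∈ quotField D) : IsUnitaryIdeal D R (Ideal.span {r}) :=
  ⟨r, Ideal.mem_span_singleton_self r, hr, hrD⟩

theorem IsUnitaryIdeal.ne_zero {F : Type*} [Field F] {D R : Subring F} {r : R}
    (h : IsUnitaryIdeal D R (Ideal.span {r})) : r ≠ 0 := by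
  rintro rfl
  obtain ⟨x, hx, hx0, -⟩ := h
  exact hx0 (by simpa using hx)

theorem dvd_inf_subfield_iff {F : Type*} [Field F] {R : Subring F} {K : Subfield F}
    {a b : ↥(R ⊓ K.toSubring)} :
    a ∣ b ↔ (⟨a, a.2.1⟩ : R) ∣ ⟨b, b.2.1⟩ := by
  constructor
  · rintro ⟨c, rfl⟩
    exact ⟨⟨c, c.2.1⟩, rfl⟩
  · rintro ⟨c, hc⟩
    have hbc : (b : F) = a * c := congrArg Subtype.val hc
    by_cases ha : (a : F) = 0
    · refine ⟨0, Subtype.ext ?_⟩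
      simp [hbc, ha]
    · have hcK : (c : F) ∈ K := by
        rw [eq_div_of_mul_eq ha ((mul_comm _ _).trans hbc.symm)]
        exact K.div_mem b.2.2 a.2.2
      exact ⟨⟨c, c.2, hcK⟩, Subtype.ext hbc⟩

theorem span_singleton_inf_subfield_eq_iff {F : Type*} [Field F] {R : Subring F} {K : Subfield F}
    {a b : ↥(R ⊓ K.toSubring)} :
    Ideal.span {a} = Ideal.span {b} ↔
      Ideal.span {(⟨a, a.2.1⟩ : R)} = Ideal.span {(⟨b, b.2.1⟩ : R)} := by
  simp only [le_antisymm_iff, Ideal.span_singleton_le_span_singleton, dvd_inf_subfield_iff]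

/-- Let `D ⊆ R` be domains, `K` the quotient field of `D`, and
`A := R ∩ K`.  Then `R` is pseudo-polynomial over `D` iff `R` is pseudo-polynomial
over `A` and `A` is pseudo-polynomial over `D`. -/
theorem isPseudoPoly_split {F : Type*} [Field F] (D R : Subring F) (hDR : D ≤ R) :
    IsPseudoPoly D R ↔
      (IsPseudoPoly (R ⊓ (quotField D).toSubring) R ∧
        IsPseudoPoly D (R ⊓ (quotField D).toSubring)) := by
  constructor
  · intro h
    refine ⟨fun r hr => ?_, fun a ha => ?_⟩
    · rw [IsUnitaryIdeal, quotField_inf_quotField hDR] at hr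
      obtain ⟨d, hd, hrd⟩ := h r hr
      exact ⟨d, ⟨d.2, Subfield.subset_closure hd⟩, hrd⟩
    · have ha0 : (⟨a, a.2.1⟩ : R) ≠ 0 := fun h0 =>
        ha.ne_zero (Subtype.ext (congrArg (fun x : R => (x : F)) h0))
      obtain ⟨d, hd, had⟩ := h _ (isUnitaryIdeal_span_singleton_of_mem ha0 a.2.2)
      exact ⟨⟨d, d.2, Subfield.subset_closure hd⟩, hd,
        span_singleton_inf_subfield_eq_iff.2 had⟩
  · rintro ⟨hRA, hAD⟩ r hr
    have hrA : IsUnitaryIdeal (R ⊓ (quotField D).toSubring) R (Ideal.span {r}) := by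
      rwa [IsUnitaryIdeal, quotField_inf_quotField hDR]
    obtain ⟨a, haA, hra⟩ := hRA r hrA
    have ha0 : a ≠ 0 := (hra ▸ hr).ne_zero
    let a' : ↥(R ⊓ (quotField D).toSubring) := ⟨a, haA⟩
    have ha0' : a' ≠ 0 := fun h0 => ha0 (Subtype.ext (congrArg
      (fun x : ↥(R ⊓ (quotField D).toSubring) => (x : F)) h0))
    obtain ⟨d, hd, had⟩ := hAD a' (isUnitaryIdeal_span_singleton_of_mem ha0' haA.2)
    have had' := span_singleton_inf_subfield_eq_iff.1 had
    exact ⟨⟨d, d.2.1⟩, hd, hra.trans had'⟩
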